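/- Let n ≥ 1, let F : ℝⁿ → ℝ be a homogeneous polynomial of degree d ≥ 1, let Γ ⊂ ℝⁿ be a lattice of full rank with dual covolume Vol(Γ*) = 1/|det(v_1, …, v_n)|, and let h ∈ ℝⁿ be a fixed shift vector. Define the shifted weighted counting function 𝓜ʰ(R) = Σ_{λ∈Γ} F(λ+h)·1_{|λ+h|≤R}. Then as R → ∞, 𝓜ʰ(R) = (Vol(Γ*) ∫_{|x|≤1} F(x) dx) · R^{d+n} + O(R^{d+n−2/(n+1)}), with the same leading coefficient as in the unshifted case. -/

import Mathlib

open MeasureTheory Filter Asymptotics Finset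

theorem MvPolynomial.IsHomogeneous.eval_const_mul {σ R : Type*} [CommSemiring R]
    {P : MvPolynomial σ R} {d : ℕ} (hP : P.IsHomogeneous d) (r : R) (x : σ → R) :
    MvPolynomial.eval (fun i => r * x i) P = r ^ d * MvPolynomial.eval x P := by
  rw [MvPolynomial.eval_eq, MvPolynomial.eval_eq, Finset.mul_sum]
  refine Finset.sum_congr rfl fun m hm => ?_
  rw [hP.degree_eq_sum_deg_support hm, ← Finset.prod_pow_eq_pow_sum]
  simp_rw [mul_pow, Finset.prod_mul_distrib]
  ring

theorem MvPolynomial.contDiff_eval_euclideanSpace {ι : Type*} [Fintype ι]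
    (P : MvPolynomial ι ℝ) (k : WithTop ℕ∞) :
    ContDiff ℝ k (fun x : EuclideanSpace ℝ ι => MvPolynomial.eval (fun i => x i) P) := by
  induction P using MvPolynomial.induction_on with
  | C a => simpa using contDiff_const
  | add p q hp hq => simpa using hp.add hq
  | mul_X p i hp =>
    simp only [map_mul, MvPolynomial.eval_X]
    exact hp.mul (by fun_prop)

/-- A `C¹` function is Lipschitz on closed balls of a finite-dimensional space. -/
theorem ContDiff.exists_norm_sub_le_on_closedBall {E : Type*} [NormedAddCommGroup E]
    [NormedSpace ℝ E] [FiniteDimensional ℝ E] {f : E → ℝ} (hf : ContDiff ℝ 1 f) (r : ℝ) :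
    ∃ K : ℝ, 0 ≤ K ∧ ∀ x y : E, ‖x‖ ≤ r → ‖y‖ ≤ r → |f x - f y| ≤ K * ‖x - y‖ := by
  obtain ⟨K, hK⟩ := (isCompact_closedBall (0 : E) r).exists_bound_of_continuousOn
    (hf.continuous_fderiv one_ne_zero).continuousOn
  refine ⟨max K 0, le_max_right _ _, fun x y hx hy => ?_⟩
  exact (convex_closedBall (0 : E) r).norm_image_sub_le_of_norm_fderiv_le (𝕜 := ℝ)
    (fun z _ => hf.differentiable one_ne_zero z)
    (fun z hz => (hK z hz).trans (le_max_left _ _)) (by simpa using hy) (by simpa using hx)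

/-- A homogeneous `C¹` function of degree `d ≥ 1` has Lipschitz constant `O(r ^ (d - 1))` on the
ball of radius `r`. -/
theorem ContDiff.exists_norm_sub_le_of_homogeneous {E : Type*} [NormedAddCommGroup E]
    [NormedSpace ℝ E] [FiniteDimensional ℝ E] {f : E → ℝ} (hf : ContDiff ℝ 1 f) {d : ℕ}
    (hd : 1 ≤ d) (hom : ∀ (r : ℝ) (x : E), f (r • x) = r ^ d * f x) :
    ∃ K : ℝ, 0 ≤ K ∧ ∀ (r : ℝ) (x y : E), 0 < r → ‖x‖ ≤ r → ‖y‖ ≤ r →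
      |f x - f y| ≤ K * r ^ (d - 1) * ‖x - y‖ := by
  obtain ⟨K, hK0, hK⟩ := hf.exists_norm_sub_le_on_closedBall 1
  refine ⟨K, hK0, fun r x y hr hx hy => ?_⟩
  have hscale : ∀ z : E, ‖z‖ ≤ r → ‖r⁻¹ • z‖ ≤ 1 := fun z hz => by
    rw [norm_smul, norm_inv, Real.norm_of_nonneg hr.le]
    exact inv_mul_le_one_of_le₀ hz hr.le
  have hval : ∀ z : E, f z = r ^ d * f (r⁻¹ • z) := fun z => by
    rw [← hom, smul_inv_smul₀ hr.ne']
  have key := hK _ _ (hscale x hx) (hscale y hy)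
  rw [← smul_sub, norm_smul, norm_inv, Real.norm_of_nonneg hr.le] at key
  rw [hval x, hval y, ← mul_sub, abs_mul, abs_of_pos (pow_pos hr d)]
  calc r ^ d * |f (r⁻¹ • x) - f (r⁻¹ • y)| ≤ r ^ d * (K * (r⁻¹ * ‖x - y‖)) := by gcongr
    _ = K * r ^ (d - 1) * ‖x - y‖ := by
      obtain ⟨e, rfl⟩ := Nat.exists_eq_add_of_le' hd
      rw [Nat.add_sub_cancel, pow_succ]
      field_simp

open scoped Pointwise in
theorem ZSpan.hasSum_setIntegral_fundamentalDomain {E ι : Type*} [NormedAddCommGroup E]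
    [NormedSpace ℝ E] [MeasurableSpace E] [BorelSpace E] [Fintype ι] (b : Module.Basis ι ℝ E)
    (μ : Measure E) [μ.IsAddHaarMeasure] {f : E → ℝ} (hf : Integrable f μ) :
    HasSum (fun ℓ : ι → ℤ => ∫ y in ZSpan.fundamentalDomain b, f ((∑ j, (ℓ j : ℝ) • b j) + y) ∂μ)
      (∫ x, f x ∂μ) := by
  have hD := ZSpan.isAddFundamentalDomain b μ
  have hinv : VAddInvariantMeasure (Submodule.span ℤ (Set.range b)) E μ :=
    inferInstanceAs <| VAddInvariantMeasure (Submodule.span ℤ (Set.range b)).toAddSubgroup E μ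
  have hcount : Countable (Submodule.span ℤ (Set.range b)) :=
    (b.restrictScalars ℤ).equivFun.toEquiv.countable_iff.2 inferInstance
  have hsum := hasSum_integral_measure
    (μ := fun g : Submodule.span ℤ (Set.range b) => μ.restrict (g +ᵥ ZSpan.fundamentalDomain b))
    (f := f) (by rwa [hD.sum_restrict])
  rw [hD.sum_restrict] at hsum
  rw [← (b.restrictScalars ℤ).equivFun.symm.toEquiv.hasSum_iff] at hsum
  refine (congrArg (HasSum · _) (funext fun ℓ => ?_)).mpr hsum
  set g := (b.restrictScalars ℤ).equivFun.symm ℓ with hg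
  have hgv : (g : E) = ∑ j, (ℓ j : ℝ) • b j := by
    simp [hg, Module.Basis.equivFun_symm_apply, Int.cast_smul_eq_zsmul]
  rw [← hgv]
  exact ((measurePreserving_vadd g μ).setIntegral_image_emb
    (measurableEmbedding_const_vadd g) f _).symm

theorem ZSpan.volume_real_fundamentalDomain_euclideanSpace {ι : Type*} [Fintype ι] [DecidableEq ι]
    (b : Module.Basis ι ℝ (EuclideanSpace ℝ ι)) :
    volume.real (ZSpan.fundamentalDomain b) = |(Matrix.of fun i j => b j i).det| := by
  have hunit : volume (ZSpan.fundamentalDomain (EuclideanSpace.basisFun ι ℝ).toBasis) = 1 := by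
    rw [measure_congr (ZSpan.fundamentalDomain_ae_parallelepiped _ volume)]
    simpa using (EuclideanSpace.basisFun ι ℝ).volume_parallelepiped
  rw [measureReal_def, ZSpan.measure_fundamentalDomain b volume
    (EuclideanSpace.basisFun ι ℝ).toBasis, hunit, mul_one, ENNReal.toReal_ofReal (abs_nonneg _),
    Module.Basis.det_apply]
  rfl

theorem setIntegral_closedBall_of_homogeneous {E : Type*} [NormedAddCommGroup E]
    [NormedSpace ℝ E] [FiniteDimensional ℝ E] [MeasurableSpace E] [BorelSpace E]
    (μ : Measure E) [μ.IsAddHaarMeasure] {f : E → ℝ} {d : ℕ}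
    (hom : ∀ (r : ℝ) (x : E), f (r • x) = r ^ d * f x) {R : ℝ} (hR : 0 < R) :
    ∫ x in Metric.closedBall 0 R, f x ∂μ =
      (∫ x in Metric.closedBall 0 1, f x ∂μ) * R ^ (d + Module.finrank ℝ E) := by
  have key := Measure.setIntegral_comp_smul_of_pos μ f (Metric.closedBall 0 1) hR
  rw [smul_unitClosedBall_of_nonneg hR.le, smul_eq_mul] at key
  simp_rw [hom, integral_const_mul] at key
  rw [eq_inv_mul_iff_mul_eq₀ (by positivity)] at key
  rw [← key]
  ring

/-- The comparison function for the oscillation over a cell of diameter `C` of a function which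
is cut off at radius `R`. -/
theorem abs_indicator_closedBall_sub_le {E : Type*} [NormedAddCommGroup E] {f : E → ℝ}
    {A B C R : ℝ} (hC : 0 ≤ C) (hA : 0 ≤ A) (hB : 0 ≤ B)
    (hlip : ∀ x y, ‖x‖ ≤ R → ‖y‖ ≤ R → |f x - f y| ≤ A * ‖x - y‖)
    (hbd : ∀ x, ‖x‖ ≤ R → |f x| ≤ B) {x z : E} (hxz : ‖x - z‖ ≤ C) :
    |(Metric.closedBall 0 R).indicator f x - (Metric.closedBall 0 R).indicator f z| ≤
      (Metric.closedBall (0 : E) R).indicator (fun _ => A * C) z +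
      (Metric.closedBall (0 : E) (R + C) \ Metric.closedBall 0 (R - C)).indicator
        (fun _ => B) z := by
  have h1 : ‖x‖ ≤ ‖z‖ + C := by linarith [norm_sub_norm_le x z]
  have h2 : ‖z‖ ≤ ‖x‖ + C := by linarith [norm_sub_norm_le z x, norm_sub_rev x z]
  have hB' : 0 ≤ (Metric.closedBall (0 : E) (R + C) \ Metric.closedBall 0 (R - C)).indicator
      (fun _ => B) z := Set.indicator_nonneg (fun _ _ => hB) z
  have hAC : 0 ≤ A * C := mul_nonneg hA hC
  by_cases hx : ‖x‖ ≤ R <;> by_cases hz : ‖z‖ ≤ R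
  · have := (hlip x z hx hz).trans (mul_le_mul_of_nonneg_left hxz hA)
    simpa [Set.indicator_of_mem, hx, hz] using this.trans (le_add_of_nonneg_right hB')
  · have hz' : z ∈ Metric.closedBall (0 : E) (R + C) \ Metric.closedBall 0 (R - C) := by
      simp only [Set.mem_sdiff, mem_closedBall_zero_iff]
      constructor <;> linarith
    rw [Set.indicator_of_mem hz']
    simpa [Set.indicator, hx, hz] using hbd x hx
  · have hz' : z ∈ Metric.closedBall (0 : E) (R + C) \ Metric.closedBall 0 (R - C) := by
      simp only [Set.mem_sdiff, mem_closedBall_zero_iff]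
      constructor <;> linarith
    rw [Set.indicator_of_mem hz']
    simpa [Set.indicator, hx, hz] using (hbd z hz).trans (le_add_of_nonneg_left hAC)
  · simpa [Set.indicator, hx, hz] using hB'

/-- A lattice sum differs from the corresponding integral by at most the integral of a bound for
the oscillation over the translated cells. -/
theorem ZSpan.abs_volume_mul_tsum_sub_integral_le {E ι : Type*} [NormedAddCommGroup E]
    [NormedSpace ℝ E] [MeasurableSpace E] [BorelSpace E] [Fintype ι] (b : Module.Basis ι ℝ E)
    (μ : Measure E) [μ.IsAddHaarMeasure] {g β : E → ℝ} (hg : Integrable g μ) (hβ : Integrable β μ)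
    (hosc : ∀ x, ∀ y ∈ ZSpan.fundamentalDomain b, |g x - g (x + y)| ≤ β (x + y)) (h : E) :
    |μ.real (ZSpan.fundamentalDomain b) * ∑' ℓ : ι → ℤ, g ((∑ j, (ℓ j : ℝ) • b j) + h)
      - ∫ x, g x ∂μ| ≤ ∫ x, β x ∂μ := by
  have : FiniteDimensional ℝ E := b.finiteDimensional_of_finite
  set D := ZSpan.fundamentalDomain b
  have hDfin : μ D ≠ ⊤ := (ZSpan.fundamentalDomain_isBounded b).measure_lt_top.ne
  have hDmeas : MeasurableSet D := ZSpan.fundamentalDomain_measurableSet b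
  have hsg := ZSpan.hasSum_setIntegral_fundamentalDomain b μ (hg.comp_add_right h)
  have hsβ := ZSpan.hasSum_setIntegral_fundamentalDomain b μ (hβ.comp_add_right h)
  rw [integral_add_right_eq_self g h] at hsg
  rw [integral_add_right_eq_self β h] at hsβ
  have hbound : ∀ ℓ : ι → ℤ,
      ‖μ.real D * g ((∑ j, (ℓ j : ℝ) • b j) + h)
        - ∫ y in D, g ((∑ j, (ℓ j : ℝ) • b j) + y + h) ∂μ‖ ≤
      ∫ y in D, β ((∑ j, (ℓ j : ℝ) • b j) + y + h) ∂μ := fun ℓ => by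
    set p := ∑ j, (ℓ j : ℝ) • b j
    have hgi : IntegrableOn (fun y => g (p + y + h)) D μ :=
      ((hg.comp_add_right h).comp_add_left p).integrableOn
    have hβi : IntegrableOn (fun y => β (p + y + h)) D μ :=
      ((hβ.comp_add_right h).comp_add_left p).integrableOn
    have hci : IntegrableOn (fun _ => g (p + h)) D μ := integrableOn_const hDfin
    rw [← smul_eq_mul, ← setIntegral_const, ← integral_sub hci hgi]
    refine norm_integral_le_of_norm_le hβi ?_
    filter_upwards [ae_restrict_mem hDmeas] with y hy
    simpa [add_right_comm] using hosc (p + h) y hy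
  have hdiff : Summable fun ℓ : ι → ℤ => μ.real D * g ((∑ j, (ℓ j : ℝ) • b j) + h)
        - ∫ y in D, g ((∑ j, (ℓ j : ℝ) • b j) + y + h) ∂μ :=
    hsβ.summable.of_norm_bounded hbound
  have hsum : Summable fun ℓ : ι → ℤ => μ.real D * g ((∑ j, (ℓ j : ℝ) • b j) + h) := by
    exact (hdiff.add hsg.summable).congr fun ℓ => sub_add_cancel _ _
  rw [← tsum_mul_left, ← hsg.tsum_eq, ← hsum.tsum_sub hsg.summable]
  exact tsum_of_norm_bounded hsβ hbound

theorem measureReal_annulus_le {E : Type*} [NormedAddCommGroup E]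
    [NormedSpace ℝ E] [FiniteDimensional ℝ E] [MeasurableSpace E] [BorelSpace E]
    (μ : Measure E) [μ.IsAddHaarMeasure] {C R : ℝ} (hC : 0 ≤ C) (hCR : C ≤ R) :
    μ.real (Metric.closedBall (0 : E) (R + C) \ Metric.closedBall 0 (R - C)) ≤
      2 * C * Module.finrank ℝ E * (2 * R) ^ (Module.finrank ℝ E - 1) *
        μ.real (Metric.ball (0 : E) 1) := by
  have hR : 0 ≤ R := hC.trans hCR
  rw [measureReal_sdiff (Metric.closedBall_subset_closedBall (by linarith))
    Metric.isClosed_closedBall.measurableSet measure_closedBall_lt_top.ne,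
    Measure.addHaar_real_closedBall μ _ (by linarith),
    Measure.addHaar_real_closedBall μ _ (by linarith), ← sub_mul]
  gcongr
  have hpow := (le_abs_self _).trans
    (abs_pow_sub_pow_le (R + C) (R - C) (Module.finrank ℝ E))
  rw [abs_of_nonneg (add_nonneg hR hC), abs_of_nonneg (sub_nonneg.2 hCR),
    max_eq_left (by linarith), abs_of_nonneg (by linarith)] at hpow
  refine hpow.trans ?_
  rw [show R + C - (R - C) = 2 * C by ring]
  gcongr
  linarith

/-- The sum of a homogeneous function of degree `d` over the points of a shifted lattice in the
ball of radius `R` agrees with the integral over that ball up to `O(R ^ (d + n - 1))`. -/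
theorem ZSpan.exists_abs_volume_mul_tsum_sub_le {E ι : Type*} [NormedAddCommGroup E]
    [NormedSpace ℝ E] [MeasurableSpace E] [BorelSpace E] [Fintype ι] (b : Module.Basis ι ℝ E)
    (μ : Measure E) [μ.IsAddHaarMeasure] {f : E → ℝ} (hf : ContDiff ℝ 1 f) {d : ℕ}
    (hd : 1 ≤ d) (hn : 1 ≤ Module.finrank ℝ E)
    (hom : ∀ (r : ℝ) (x : E), f (r • x) = r ^ d * f x) (h : E) :
    ∃ K : ℝ, ∀ᶠ R : ℝ in atTop,
      |μ.real (ZSpan.fundamentalDomain b) * ∑' ℓ : ι → ℤ,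
          (Metric.closedBall 0 R).indicator f ((∑ j, (ℓ j : ℝ) • b j) + h)
        - (∫ x in Metric.closedBall 0 1, f x ∂μ) * R ^ (d + Module.finrank ℝ E)| ≤
      K * R ^ (d + Module.finrank ℝ E - 1) := by
  have : FiniteDimensional ℝ E := b.finiteDimensional_of_finite
  obtain ⟨K, hK0, hK⟩ := hf.exists_norm_sub_le_of_homogeneous hd hom
  obtain ⟨C, hC0, hC⟩ := (ZSpan.fundamentalDomain_isBounded b).exists_pos_norm_le
  set n := Module.finrank ℝ E
  set ω := μ.real (Metric.ball (0 : E) 1)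
  refine ⟨K * C * ω + K * (2 * C * n * 2 ^ (n - 1) * ω), ?_⟩
  filter_upwards [eventually_ge_atTop C] with R hCR
  have hR : 0 < R := hC0.trans_le hCR
  have hf0 : f 0 = 0 := by simpa [(Nat.one_le_iff_ne_zero.1 hd)] using hom 0 0
  have hbd : ∀ x : E, ‖x‖ ≤ R → |f x| ≤ K * R ^ d := fun x hx => by
    have := hK R x 0 hR hx (by simpa using hR.le)
    rw [hf0, sub_zero, sub_zero] at this
    refine this.trans ?_
    rw [← Nat.sub_add_cancel hd, pow_succ, Nat.add_sub_cancel, mul_assoc]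
    gcongr
  have hballm : ∀ r : ℝ, MeasurableSet (Metric.closedBall (0 : E) r) := fun r =>
    Metric.isClosed_closedBall.measurableSet
  have hg : Integrable ((Metric.closedBall (0 : E) R).indicator f) μ :=
    (integrable_indicator_iff (hballm R)).2
      (hf.continuous.continuousOn.integrableOn_compact (isCompact_closedBall _ _))
  have hβ1 : Integrable ((Metric.closedBall (0 : E) R).indicator
      (fun _ => K * R ^ (d - 1) * C)) μ :=
    (integrable_indicator_iff (hballm R)).2 (integrableOn_const measure_closedBall_lt_top.ne)
  have hannm := (hballm (R + C)).diff (hballm (R - C))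
  have hβ2 : Integrable ((Metric.closedBall (0 : E) (R + C) \
      Metric.closedBall 0 (R - C)).indicator (fun _ => K * R ^ d)) μ :=
    (integrable_indicator_iff hannm).2
      (integrableOn_const ((measure_mono Set.sdiff_subset).trans_lt measure_closedBall_lt_top).ne)
  have key := ZSpan.abs_volume_mul_tsum_sub_integral_le b μ hg (hβ1.add hβ2)
    (fun x y hy => abs_indicator_closedBall_sub_le hC0.le (by positivity) (by positivity)
      (fun x y => hK R x y hR) hbd (by simpa using hC y hy)) h
  rw [integral_indicator (hballm R), setIntegral_closedBall_of_homogeneous μ hom hR] at key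
  refine key.trans ?_
  simp only [Pi.add_apply]
  rw [integral_add hβ1 hβ2, integral_indicator_const _ (hballm R),
    integral_indicator_const _ hannm, Measure.addHaar_real_closedBall μ _ hR.le, smul_eq_mul,
    smul_eq_mul, add_mul]
  have hann := measureReal_annulus_le μ hC0.le hCR
  refine add_le_add (le_of_eq ?_) ((mul_le_mul_of_nonneg_right hann (by positivity)).trans
    (le_of_eq ?_))
  · rw [show d + n - 1 = n + (d - 1) by omega, pow_add]
    ring
  · rw [show d + n - 1 = d + (n - 1) by omega, pow_add, mul_pow]
    ring

/-- **Shifted weighted lattice point counting (remark after Theorem 3.1).**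
For a homogeneous polynomial `F` of degree `d ≥ 1`, a full-rank lattice `Γ` generated by a
basis `v₁, …, vₙ` of `ℝⁿ` and a fixed shift `h ∈ ℝⁿ`, the shifted counting function
`𝓜ʰ(R) = Σ_{λ ∈ Γ} F(λ+h) 1_{|λ+h| ≤ R}` satisfies
`𝓜ʰ(R) = (Vol(Γ*) ∫_{|x|≤1} F) R^{d+n} + O(R^{d+n-2/(n+1)})` as `R → ∞`,
with the same leading coefficient as in the unshifted case. -/
theorem stmt1 (n d : ℕ) (hn : 1 ≤ n) (hd : 1 ≤ d)
    (P : MvPolynomial (Fin n) ℝ) (hP : P.IsHomogeneous d)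
    (v : Fin n → EuclideanSpace ℝ (Fin n))
    (hv : LinearIndependent ℝ v) (hspan : Submodule.span ℝ (Set.range v) = ⊤)
    (h : EuclideanSpace ℝ (Fin n))
    (𝓜h : ℝ → ℝ)
    (h𝓜 : ∀ R : ℝ, 𝓜h R = ∑' ℓ : Fin n → ℤ,
      if ‖(∑ j, (ℓ j : ℝ) • v j) + h‖ ≤ R then
        MvPolynomial.eval (fun i => ((∑ j, (ℓ j : ℝ) • v j) + h) i) P else 0) :
    (fun R : ℝ => 𝓜h R -
        ((1 / |(Matrix.of fun i j => v j i).det|) *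
            ∫ x in Metric.closedBall (0 : EuclideanSpace ℝ (Fin n)) 1,
              MvPolynomial.eval (fun i => x i) P) * R ^ (d + n))
      =O[atTop] (fun R : ℝ => R ^ ((d : ℝ) + n - 2 / (n + 1))) := by
  set b : Module.Basis (Fin n) ℝ (EuclideanSpace ℝ (Fin n)) := Module.Basis.mk hv hspan.ge with hb
  have hbv : ∀ j, b j = v j := fun j => by simp [hb]
  set f : EuclideanSpace ℝ (Fin n) → ℝ := fun x => MvPolynomial.eval (fun i => x i) P with hfdef
  have hom : ∀ (r : ℝ) (x : EuclideanSpace ℝ (Fin n)), f (r • x) = r ^ d * f x := fun r x => by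
    simpa [hfdef] using hP.eval_const_mul r (fun i => x i)
  have hfr : Module.finrank ℝ (EuclideanSpace ℝ (Fin n)) = n := by simp
  obtain ⟨K, hK⟩ := ZSpan.exists_abs_volume_mul_tsum_sub_le b volume
    (P.contDiff_eval_euclideanSpace 1) hd (hfr.symm ▸ hn) hom h
  have hvol := ZSpan.volume_real_fundamentalDomain_euclideanSpace b
  simp only [hbv] at hvol hK
  rw [hfr, hvol] at hK
  have hV : 0 < |(Matrix.of fun i j => v j i).det| := by
    rw [← hvol]
    exact ENNReal.toReal_pos (ZSpan.measure_fundamentalDomain_ne_zero b)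
      (ZSpan.fundamentalDomain_isBounded b).measure_lt_top.ne
  set V := |(Matrix.of fun i j => v j i).det|
  refine IsBigO.of_bound (V⁻¹ * K) ?_
  filter_upwards [hK, eventually_ge_atTop 1] with R hR hR1
  have hM : 𝓜h R = ∑' ℓ : Fin n → ℤ,
      (Metric.closedBall 0 R).indicator f ((∑ j, (ℓ j : ℝ) • v j) + h) := by
    rw [h𝓜 R]
    refine tsum_congr fun ℓ => ?_
    simp only [Set.indicator, mem_closedBall_zero_iff, hfdef]
  rw [← hM] at hR
  have hR0 : 0 < R := by linarith
  have hexp : R ^ (d + n - 1) ≤ R ^ ((d : ℝ) + n - 2 / (n + 1)) := by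
    rw [← Real.rpow_natCast]
    refine Real.rpow_le_rpow_of_exponent_le hR1 ?_
    have hn' : (1 : ℝ) ≤ n := by exact_mod_cast hn
    have : (2 : ℝ) / (n + 1) ≤ 1 := by rw [div_le_one (by positivity)]; linarith
    rw [Nat.cast_sub (by omega)]
    push_cast
    linarith
  have hK0 : 0 ≤ K := nonneg_of_mul_nonneg_left ((abs_nonneg _).trans hR) (by positivity)
  rw [Real.norm_eq_abs, Real.norm_of_nonneg (by positivity)]
  calc |𝓜h R - 1 / V * (∫ x in Metric.closedBall 0 1, f x) * R ^ (d + n)|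
      = V⁻¹ * |V * 𝓜h R - (∫ x in Metric.closedBall 0 1, f x) * R ^ (d + n)| := by
        have habs : ∀ t : ℝ, V⁻¹ * |t| = |V⁻¹ * t| := fun t => by
          rw [abs_mul, abs_of_pos (inv_pos.2 hV)]
        rw [habs, mul_sub, inv_mul_cancel_left₀ hV.ne', one_div, mul_assoc]
    _ ≤ V⁻¹ * (K * R ^ (d + n - 1)) := by gcongr
    _ ≤ V⁻¹ * K * R ^ ((d : ℝ) + n - 2 / (n + 1)) := by
        rw [← mul_assoc]
        gcongr
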